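/- arXiv:1704.08790 — 2 statements merged into one kernel-verified Lean document; each statement's English description precedes it below -/
import Mathlib

section
/- Let f : Ordinal → Ordinal be normal with 0 < f 0, and let α > 0. Then φ[f]_α 0 is the supremum of the set { (φ[f]_β)^[n] 0 : β < α, n ∈ ℕ }, where (φ[f]_β)^[n] denotes the n-th iterate of φ[f]_β. -/
open Ordinal

/-- The derivative of a family of normal functions indexed by the ordinals below `o`
(the old Mathlib definition, since removed). -/
noncomputable def Ordinal.derivBFamily.{u, v} (o : Ordinal.{u})
    (f : ∀ b < o, Ordinal.{max u v} → Ordinal.{max u v}) :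
    Ordinal.{max u v} → Ordinal.{max u v} :=
  Ordinal.derivFamily (Ordinal.familyOfBFamily o f)

/-- The Veblen hierarchy with base `f`: `veblen f 0 = f`, and for `α > 0`,
`veblen f α` is the function enumerating the common fixed points of the functions
`veblen f β` for `β < α` (the derivative of the family). -/
noncomputable def veblen (f : Ordinal → Ordinal) (α : Ordinal) : Ordinal → Ordinal :=
  if α = 0 then f
  else Ordinal.derivBFamily α fun β (_ : β < α) => veblen f β
termination_by α
decreasing_by assumption

universe uu vv

theorem vb_zero (f : Ordinal.{max uu vv} → Ordinal.{max uu vv}) :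
    _root_.veblen.{vv, uu} f 0 = f := by
  rw [_root_.veblen]; simp

theorem vb_pos (f : Ordinal.{max uu vv} → Ordinal.{max uu vv}) {α : Ordinal.{uu}} (h : α ≠ 0) :
    _root_.veblen.{vv, uu} f α = Ordinal.derivFamily (Ordinal.familyOfBFamily α
      (fun β (_ : β < α) => _root_.veblen.{vv, uu} f β)) := by
  rw [_root_.veblen, if_neg h]; rfl

theorem vb_normal (f : Ordinal.{max uu vv} → Ordinal.{max uu vv}) (hf : Order.IsNormal f)
    (α : Ordinal.{uu}) : Order.IsNormal (_root_.veblen.{vv, uu} f α) := by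
  by_cases h : α = 0
  · subst h; rw [vb_zero]; exact hf
  · rw [vb_pos f h]
    haveI : Small.{max uu vv} α.ToType := small_max.{vv} _
    exact Ordinal.isNormal_derivFamily _

theorem vb_fp (f : Ordinal.{max uu vv} → Ordinal.{max uu vv}) (hf : Order.IsNormal f)
    {β α : Ordinal.{uu}} (h : β < α) (a : Ordinal.{max uu vv}) :
    _root_.veblen.{vv, uu} f β (_root_.veblen.{vv, uu} f α a) = _root_.veblen.{vv, uu} f α a := by
  rw [vb_pos f (α := α) (ne_bot_of_gt h)]
  haveI : Small.{max uu vv} α.ToType := small_max.{vv} _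
  have key := Ordinal.familyOfBFamily_enum α
    (fun β (_ : β < α) => _root_.veblen.{vv, uu} f β) β h
  have := Ordinal.derivFamily_fp (f := Ordinal.familyOfBFamily α
    (fun β (_ : β < α) => _root_.veblen.{vv, uu} f β)) (by rw [key]; exact vb_normal f hf β) a
  rwa [key] at this

theorem vb_mono (f : Ordinal.{max uu vv} → Ordinal.{max uu vv}) (hf : Order.IsNormal f)
    {β α : Ordinal.{uu}} (h : β ≤ α) (a : Ordinal.{max uu vv}) :
    _root_.veblen.{vv, uu} f β a ≤ _root_.veblen.{vv, uu} f α a := by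
  rcases h.eq_or_lt with rfl | h
  · exact le_rfl
  · rw [← vb_fp f hf h a]
    exact (vb_normal f hf β).strictMono.monotone (vb_normal f hf α).strictMono.le_apply

theorem vb_iter_mono (f : Ordinal.{max uu vv} → Ordinal.{max uu vv}) (hf : Order.IsNormal f)
    {β α : Ordinal.{uu}} (h : β ≤ α) (n : ℕ) :
    (_root_.veblen.{vv, uu} f β)^[n] 0 ≤ (_root_.veblen.{vv, uu} f α)^[n] 0 :=
  (vb_normal f hf β).strictMono.monotone.iterate_le_of_le (fun a => vb_mono f hf h a) n 0

theorem vb_foldr (f : Ordinal.{max uu vv} → Ordinal.{max uu vv}) (hf : Order.IsNormal f)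
    {α : Ordinal.{uu}} (hα : 0 < α) (l : List α.ToType) :
    ∃ β < α, ∃ n : ℕ, List.foldr (Ordinal.familyOfBFamily α
      (fun β (_ : β < α) => _root_.veblen.{vv, uu} f β)) 0 l ≤
        (_root_.veblen.{vv, uu} f β)^[n] 0 := by
  induction l with
  | nil => exact ⟨0, hα, 0, by simp⟩
  | cons i l ih =>
    obtain ⟨β, hβ, n, hn⟩ := ih
    obtain ⟨γ, hγ, hi⟩ : ∃ γ < α, Ordinal.familyOfBFamily α
      (fun β (_ : β < α) => _root_.veblen.{vv, uu} f β) i = _root_.veblen.{vv, uu} f γ :=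
      ⟨_, Ordinal.typein_lt_self i, rfl⟩
    refine ⟨max β γ, max_lt hβ hγ, n + 1, ?_⟩
    rw [List.foldr_cons, hi, Function.iterate_succ_apply']
    calc _ ≤ _root_.veblen.{vv, uu} f γ ((_root_.veblen.{vv, uu} f (max β γ))^[n] 0) :=
          (vb_normal f hf γ).strictMono.monotone
            (hn.trans (vb_iter_mono f hf (le_max_left _ _) n))
      _ ≤ _ := vb_mono f hf (le_max_right _ _) _

/-- For normal `f` with `0 < f 0` and `α > 0`, `veblen f α 0` is the
supremum of the set of iterates `(veblen f β)^[n] 0` for `β < α` and `n : ℕ`. -/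
theorem stmt6 (f : Ordinal → Ordinal) (hf : Order.IsNormal f) (h0 : 0 < f 0)
    {α : Ordinal} (hα : 0 < α) :
    veblen f α 0 = sSup { x : Ordinal | ∃ β < α, ∃ n : ℕ, (veblen f β)^[n] 0 = x } := by
  have hub : ∀ x ∈ { x : Ordinal | ∃ β < α, ∃ n : ℕ, (_root_.veblen f β)^[n] 0 = x },
      x ≤ _root_.veblen f α 0 := by
    rintro x ⟨β, hβ, n, rfl⟩
    calc (_root_.veblen f β)^[n] 0 ≤ (_root_.veblen f β)^[n] (_root_.veblen f α 0) :=
          (vb_normal f hf β).strictMono.monotone.iterate n zero_le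
      _ = _ := Function.iterate_fixed (vb_fp f hf hβ 0) n
  apply le_antisymm
  · rw [vb_pos f hα.ne', Ordinal.derivFamily_zero]
    apply Ordinal.nfpFamily_le
    intro l
    obtain ⟨β, hβ, n, hn⟩ := vb_foldr f hf hα l
    exact hn.trans (le_csSup ⟨_, hub⟩ ⟨β, hβ, n, rfl⟩)
  · exact csSup_le ⟨_, 0, hα, 0, rfl⟩ hub
end

section
/- Let f : Ordinal → Ordinal be normal with 0 < f 0, and let α > 0. Then for every ordinal c, φ[f]_α (c + 1) is the supremum of the set { (φ[f]_β)^[n] (φ[f]_α c + 1) : β < α, n ∈ ℕ }, where (φ[f]_β)^[n] denotes the n-th iterate of φ[f]_β. -/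
open Ordinal

theorem veblen_aux_zero (f : Ordinal → Ordinal) : veblen f 0 = f := by
  rw [_root_.veblen, if_pos rfl]

theorem veblen_aux_pos (f : Ordinal → Ordinal) {α : Ordinal} (hα : 0 < α) :
    veblen f α = derivFamily (Ordinal.familyOfBFamily α fun β (_ : β < α) => veblen f β) := by
  rw [_root_.veblen, if_neg hα.ne', Ordinal.derivBFamily]

theorem veblen_aux_normal (f : Ordinal → Ordinal) (hf : Order.IsNormal f) (α : Ordinal) :
    Order.IsNormal (veblen f α) := by
  rcases eq_zero_or_pos α with rfl | h
  · rwa [veblen_aux_zero]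
  · rw [veblen_aux_pos f h]
    exact isNormal_derivFamily _

theorem familyAux_exists (f : Ordinal → Ordinal) (α : Ordinal) (i : α.ToType) :
    ∃ β < α, Ordinal.familyOfBFamily α (fun β (_ : β < α) => veblen f β) i = veblen f β := by
  refine ⟨_, ?_, rfl⟩
  conv_rhs => rw [← type_toType α]
  exact typein_lt_type _ _

theorem familyAux_surj (f : Ordinal → Ordinal) (α β : Ordinal) (h : β < α) :
    ∃ i, Ordinal.familyOfBFamily α (fun β (_ : β < α) => veblen f β) i = veblen f β :=
  ⟨_, familyOfBFamily_enum α (fun β (_ : β < α) => veblen f β) β h⟩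

theorem familyAux_normal (f : Ordinal → Ordinal) (hf : Order.IsNormal f) (α : Ordinal)
    (i : α.ToType) :
    Order.IsNormal (Ordinal.familyOfBFamily α (fun β (_ : β < α) => veblen f β) i) := by
  obtain ⟨β, -, h⟩ := familyAux_exists f α i
  rw [h]
  exact veblen_aux_normal f hf β

theorem veblen_aux_mono (f : Ordinal → Ordinal) (hf : Order.IsNormal f) {β γ : Ordinal}
    (h : β ≤ γ) (a : Ordinal) : veblen f β a ≤ veblen f γ a := by
  rcases h.eq_or_lt with rfl | h
  · exact le_rfl
  have hfix : veblen f β (veblen f γ a) = veblen f γ a := by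
    obtain ⟨i, hi⟩ := familyAux_surj f γ β h
    rw [veblen_aux_pos f (h.bot_lt), ← hi]
    exact derivFamily_fp (familyAux_normal f hf γ i) a
  rw [← hfix]
  exact (veblen_aux_normal f hf β).monotone (veblen_aux_normal f hf γ).strictMono.le_apply

theorem iterate_aux_mono (f : Ordinal → Ordinal) (hf : Order.IsNormal f) {β γ : Ordinal}
    (h : β ≤ γ) (a : Ordinal) (n : ℕ) : (veblen f β)^[n] a ≤ (veblen f γ)^[n] a :=
  (veblen_aux_normal f hf β).monotone.iterate_le_of_le (veblen_aux_mono f hf h) n a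

/-- For normal `f` with `0 < f 0`, `α > 0` and any `c`, `veblen f α (c+1)`
is the supremum of the set of iterates `(veblen f β)^[n] (veblen f α c + 1)`
for `β < α` and `n : ℕ`. -/
theorem stmt7 (f : Ordinal → Ordinal) (hf : Order.IsNormal f) (h0 : 0 < f 0)
    {α : Ordinal} (hα : 0 < α) (c : Ordinal) :
    veblen f α (c + 1) =
      sSup { x : Ordinal | ∃ β < α, ∃ n : ℕ, (veblen f β)^[n] (veblen f α c + 1) = x } := by
  set F := Ordinal.familyOfBFamily α (fun β (_ : β < α) => veblen f β) with hF
  have key : veblen f α (c + 1) = nfpFamily F (veblen f α c + 1) := by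
    rw [veblen_aux_pos f hα, derivFamily_add_one]
  rw [key]
  generalize veblen f α c + 1 = a
  have hub : ∀ x ∈ { x : Ordinal | ∃ β < α, ∃ n : ℕ, (veblen f β)^[n] a = x },
      x ≤ nfpFamily F a := by
    rintro x ⟨β, hβ, n, rfl⟩
    obtain ⟨i, hi⟩ := familyAux_surj f α β hβ
    rw [← hi]
    have := foldr_le_nfpFamily F a (List.replicate n i)
    convert this using 1
    clear this
    induction n with
    | zero => rfl
    | succ n ih => rw [Function.iterate_succ_apply', ih, List.replicate_succ, List.foldr_cons]
  apply le_antisymm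
  · apply nfpFamily_le
    intro l
    have : ∃ β < α, ∃ n : ℕ, List.foldr F a l ≤ (veblen f β)^[n] a := by
      induction l with
      | nil => exact ⟨0, hα, 0, le_rfl⟩
      | cons i l ih =>
        obtain ⟨β, hβ, n, h⟩ := ih
        obtain ⟨γ, hγ, hi⟩ := familyAux_exists f α i
        refine ⟨max γ β, max_lt hγ hβ, n + 1, ?_⟩
        rw [List.foldr_cons, Function.iterate_succ_apply', hF, hi]
        refine (veblen_aux_mono f hf (le_max_left γ β) _).trans ?_
        exact (veblen_aux_normal f hf _).monotone
          (h.trans (iterate_aux_mono f hf (le_max_right γ β) a n))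
    obtain ⟨β, hβ, n, h⟩ := this
    exact h.trans (le_csSup ⟨_, hub⟩ ⟨β, hβ, n, rfl⟩)
  · exact csSup_le ⟨a, 0, hα, 0, rfl⟩ hub
end
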